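/- arXiv:1601.00823 — 2 statements merged into one kernel-verified Lean document; each statement's English description precedes it below -/
import Mathlib

section
/- Let K be a field and let P ∈ K[s]^{q×m}, A ∈ K[s]^{m×m} with det A ≠ 0, and S ∈ K[s]^{m×t} be polynomial matrices such that R = P A^{−1} S is a coprime factorization: the pair (P, A) is right coprime (there exist polynomial matrices X, Y with X A + Y P = I_m) and the pair (A, S) is left coprime (there exist polynomial matrices X′, Y′ with A X′ + S Y′ = I_m). Then the dimension of a minimal realization of π₋R equals deg det A: there exists a realization (F, G, H) of π₋R with F ∈ K^{d×d} where d = deg(det A), and every realization of π₋R has dimension at least deg(det A). -/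
open Polynomial Matrix Kronecker

set_option synthInstance.maxHeartbeats 1000000
set_option maxHeartbeats 1000000

noncomputable section

variable {K : Type*} [Field K]

/-- The strictly proper part of a rational function. -/
def piMinus (f : RatFunc K) : RatFunc K :=
  f - algebraMap (Polynomial K) (RatFunc K) (f.num /ₘ f.denom)

/-- A rational function is strictly proper. -/
def IsStrictlyProper (f : RatFunc K) : Prop :=
  f.num.degree < f.denom.degree

/-- Companion matrix of a polynomial, for size `n`. -/
def companion (n : ℕ) (p : Polynomial K) : Matrix (Fin n) (Fin n) K :=
  Matrix.of fun i j =>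
    if (i : ℕ) + 1 = (j : ℕ) then 1
    else if (i : ℕ) = n - 1 then -(p.coeff (j : ℕ)) else 0

/-- The Hankel matrix `M(p)`. -/
def hankelM (n : ℕ) (p : Polynomial K) : Matrix (Fin n) (Fin n) K :=
  Matrix.of fun i j =>
    if (i : ℕ) + (j : ℕ) + 1 ≤ n then p.coeff ((i : ℕ) + (j : ℕ) + 1) else 0

/-- The matrix `N_k` with ones on the superdiagonal. -/
def supN (R : Type*) [Semiring R] (k : ℕ) : Matrix (Fin k) (Fin k) R :=
  Matrix.of fun i j => if (i : ℕ) + 1 = (j : ℕ) then 1 else 0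

/-- `V = eₙ e₁ᵀ`. -/
def eV (K : Type*) [Field K] (n : ℕ) : Matrix (Fin n) (Fin n) K :=
  Matrix.of fun i j => if (i : ℕ) = n - 1 ∧ (j : ℕ) = 0 then 1 else 0

/-- Jacobson block `J(p^k)`, as an `nk × nk` matrix indexed by `Fin k × Fin n`. -/
def jacobson (n : ℕ) (p : Polynomial K) (k : ℕ) :
    Matrix (Fin k × Fin n) (Fin k × Fin n) K :=
  (1 : Matrix (Fin k) (Fin k) K) ⊗ₖ companion n p + supN K k ⊗ₖ eV K n

/-- `sI - F` as a matrix over `K(s)`. -/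
def sISub {ι : Type*} [Fintype ι] [DecidableEq ι] (F : Matrix ι ι K) :
    Matrix ι ι (RatFunc K) :=
  Matrix.diagonal (fun _ => (RatFunc.X : RatFunc K)) - F.map (algebraMap K (RatFunc K))

/-- `b(s) = (1, s, …, s^{n-1})ᵀ` as a vector over `K(s)`. -/
def bVec (K : Type*) [Field K] (n : ℕ) : Fin n → RatFunc K :=
  fun i => (RatFunc.X : RatFunc K) ^ (i : ℕ)

/-- The rank-one matrix `b(s) b(s)ᵀ`. -/
def bbT (K : Type*) [Field K] (n : ℕ) : Matrix (Fin n) (Fin n) (RatFunc K) :=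
  Matrix.of fun i j => bVec K n i * bVec K n j

/-- The determinant of `A` is associated to the product of the Smith coefficients of its range. -/
theorem associated_det_prod_smithNormalFormCoeffs {m : ℕ} (A : Matrix (Fin m) (Fin m) K[X])
    (hA : A.det ≠ 0)
    (h : Module.finrank K[X] (LinearMap.range A.mulVecLin) =
      Module.finrank K[X] (Fin m → K[X])) :
    Associated A.det (∏ i, Submodule.smithNormalFormCoeffs (Pi.basisFun K[X] (Fin m)) h i) := by
  have hinj : Function.Injective A.mulVecLin := Matrix.mulVec_injective_of_det_ne_zero hA
  let b' := Submodule.smithNormalFormTopBasis (Pi.basisFun K[X] (Fin m)) h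
  let ab := Submodule.smithNormalFormBotBasis (Pi.basisFun K[X] (Fin m)) h
  let E := b'.equiv ab (Equiv.refl _)
  rw [← Matrix.det_diagonal, ← LinearMap.det_toLin b' (diagonal _), ← LinearMap.det_toLin' A]
  let e := E.trans (LinearEquiv.ofInjective _ hinj).symm
  refine (LinearMap.associated_det_of_eq_comp e _ _ ?_).symm
  intro x
  have h1 : Matrix.toLin' A (e x) = (E x : Fin m → K[X]) := by
    have := LinearEquiv.apply_symm_apply (LinearEquiv.ofInjective _ hinj) (E x)
    exact congrArg Subtype.val this
  rw [h1]
  suffices H : Matrix.toLin b' b'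
      (diagonal (Submodule.smithNormalFormCoeffs (Pi.basisFun K[X] (Fin m)) h)) =
      (Submodule.subtype _).comp E.toLinearMap from
    LinearMap.congr_fun H x
  refine b'.ext fun i => ?_
  rw [Matrix.toLin_self]
  simp [E, Matrix.diagonal_apply, ab, b', Submodule.smithNormalFormBotBasis_def]

theorem finrank_range_mulVecLin_of_det_ne_zero {m : ℕ} (A : Matrix (Fin m) (Fin m) K[X])
    (hA : A.det ≠ 0) : Module.finrank K[X] (LinearMap.range A.mulVecLin) =
      Module.finrank K[X] (Fin m → K[X]) :=
  LinearMap.finrank_range_of_inj (Matrix.mulVec_injective_of_det_ne_zero hA)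

/-- The module `K[s]^m / A K[s]^m`. -/
abbrev PolyCokernel {m : ℕ} (A : Matrix (Fin m) (Fin m) K[X]) : Type _ :=
  (Fin m → K[X]) ⧸ LinearMap.range A.mulVecLin

/-- The cokernel of a nonsingular polynomial matrix has `K`-dimension `deg det A`. -/
theorem finite_and_finrank_polyCokernel {m : ℕ} (A : Matrix (Fin m) (Fin m) K[X])
    (hA : A.det ≠ 0) :
    Module.Finite K (PolyCokernel A) ∧ Module.finrank K (PolyCokernel A) = A.det.natDegree := by
  have h := finrank_range_mulVecLin_of_det_ne_zero A hA
  have hne := Submodule.smithNormalFormCoeffs_ne_zero (Pi.basisFun K[X] (Fin m)) h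
  have hf (i) : Module.Finite K (K[X] ⧸ Ideal.span
      ({Submodule.smithNormalFormCoeffs (Pi.basisFun K[X] (Fin m)) h i} : Set K[X])) :=
    PowerBasis.finite <| AdjoinRoot.powerBasis <| hne i
  constructor
  · have e := Submodule.quotientEquivDirectSum K (Pi.basisFun K[X] (Fin m)) h
    exact Module.Finite.equiv e.symm
  · rw [natDegree_eq_of_degree_eq
      (degree_eq_degree_of_associated <| associated_det_prod_smithNormalFormCoeffs A hA h)]
    rw [natDegree_prod _ _ fun i _ => hne i,
      Submodule.finrank_quotient_eq_sum K (Pi.basisFun K[X] (Fin m)) h]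
    congr with i
    exact (AdjoinRoot.powerBasis <| hne i).finrank

/-- The adjugate of `sI - F` has entries of degree less than that of its determinant. -/
theorem degree_adjugate_charmatrix_lt {d : ℕ} (F : Matrix (Fin d) (Fin d) K) (i j : Fin d) :
    ((charmatrix F).adjugate i j).degree < F.charpoly.degree := by
  obtain ⟨k, -, hk⟩ := Finset.exists_max_image Finset.univ
    (fun i => ((charmatrix F).adjugate i j).degree) ⟨i, Finset.mem_univ i⟩
  refine (hk i (Finset.mem_univ i)).trans_lt ?_
  set N := (charmatrix F).adjugate with hN
  have h1 : charmatrix F * N = F.charpoly • 1 := Matrix.mul_adjugate _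
  have h2 := congrFun (congrFun h1 k) j
  have h3 : X * N k j = ∑ l, C (F k l) * N l j + F.charpoly * (1 : Matrix _ _ K[X]) k j := by
    rw [← sub_eq_iff_eq_add', ← smul_eq_mul F.charpoly, ← Matrix.smul_apply, ← h2]
    simp [charmatrix, Matrix.mul_apply, sub_mul, Matrix.diagonal_apply]
  by_contra hcon
  push Not at hcon
  have h0 : N k j ≠ 0 := by
    intro h
    rw [h, degree_zero, le_bot_iff, degree_eq_bot] at hcon
    exact F.charpoly_monic.ne_zero hcon
  have h4 : (X * N k j).degree ≤ (N k j).degree := by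
    rw [h3]
    refine (degree_add_le _ _).trans (max_le ?_ ?_)
    · refine (degree_sum_le _ _).trans (Finset.sup_le fun l hl => ?_)
      rw [← smul_eq_C_mul]
      exact (degree_smul_le _ _).trans (hk l hl)
    · rw [Matrix.one_apply]
      split_ifs
      · simpa only [mul_one] using hcon
      · simp
  rw [degree_mul, degree_X, degree_eq_natDegree h0] at h4
  norm_cast at h4
  omega

/-- Right division of a polynomial row vector by `sI - F`, with constant remainder. -/
theorem exists_eq_C_add_vecMul_charmatrix {d : ℕ} (F : Matrix (Fin d) (Fin d) K)
    (p : Fin d → K[X]) :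
    ∃ (h : Fin d → K) (l : Fin d → K[X]), p = (fun i => C (h i)) + l ᵥ* charmatrix F := by
  let Q (p : Fin d → K[X]) : Prop :=
    ∃ (h : Fin d → K) (l : Fin d → K[X]), p = (fun i => C (h i)) + l ᵥ* charmatrix F
  have hadd (p q) : Q p → Q q → Q (p + q) := by
    rintro ⟨h, l, rfl⟩ ⟨h', l', rfl⟩
    refine ⟨h + h', l + l', ?_⟩
    rw [Matrix.add_vecMul]
    ext1 i; simp; ring
  have hX (p) : Q p → Q ((X : K[X]) • p) := by
    rintro ⟨h, l, rfl⟩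
    refine ⟨h ᵥ* F, (X : K[X]) • l + fun i => C (h i), ?_⟩
    rw [Matrix.add_vecMul, smul_add, Matrix.smul_vecMul]
    have : (fun i => C (h i)) ᵥ* charmatrix F =
        (X : K[X]) • (fun i => C (h i)) - fun i => C ((h ᵥ* F) i) := by
      ext1 i
      rw [show charmatrix F = diagonal (fun _ => X) - F.map C from rfl, Matrix.vecMul_sub]
      simp only [Pi.sub_apply, Matrix.vecMul_diagonal, Pi.smul_apply, smul_eq_mul, mul_comm X]
      simp [Matrix.vecMul, dotProduct]
    rw [this]; abel
  have hC (c : K) (p) : Q p → Q (C c • p) := by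
    rintro ⟨h, l, rfl⟩
    refine ⟨c • h, C c • l, ?_⟩
    rw [Matrix.smul_vecMul]
    ext1 i; simp; ring
  have hsmul (r : K[X]) (p) (hp : Q p) : Q (r • p) := by
    induction r using Polynomial.induction_on with
    | C a => exact hC a p hp
    | add r s hr hs => rw [add_smul]; exact hadd _ _ hr hs
    | monomial n a ih =>
      rw [pow_succ', mul_left_comm, mul_smul]; exact hX _ ih
  have hp : p = ∑ i, p i • (Pi.single i 1 : Fin d → K[X]) := by
    ext1 j; simp [Finset.sum_apply, Pi.single_apply]
  change Q p
  rw [hp]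
  refine Finset.sum_induction _ Q hadd ⟨0, 0, by ext1; simp⟩ fun i _ => hsmul _ _
    ⟨Pi.single i 1, 0, ?_⟩
  ext1 j; simp [Pi.single_apply]

/-- `piMinus` discards a polynomial summand of a strictly proper fraction. -/
theorem piMinus_div_add (a b y : K[X]) (hb : a.degree < b.degree) :
    piMinus (algebraMap K[X] (RatFunc K) a / algebraMap K[X] (RatFunc K) b +
      algebraMap K[X] (RatFunc K) y) =
      algebraMap K[X] (RatFunc K) a / algebraMap K[X] (RatFunc K) b := by
  have hb0 : b ≠ 0 := by rintro rfl; simp at hb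
  have hbφ : algebraMap K[X] (RatFunc K) b ≠ 0 := RatFunc.algebraMap_ne_zero hb0
  set f := algebraMap K[X] (RatFunc K) a / algebraMap K[X] (RatFunc K) b +
      algebraMap K[X] (RatFunc K) y with hf
  have hd : algebraMap K[X] (RatFunc K) f.denom ≠ 0 := RatFunc.algebraMap_ne_zero f.denom_ne_zero
  have h1 : (f.num - f.denom * y) * b = a * f.denom := by
    apply RatFunc.algebraMap_injective K
    have h2 := f.num_div_denom
    rw [div_eq_iff hd] at h2
    simp only [map_mul, map_sub]
    rw [h2]
    have h3 : f * algebraMap K[X] (RatFunc K) b =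
        algebraMap K[X] (RatFunc K) a +
          algebraMap K[X] (RatFunc K) y * algebraMap K[X] (RatFunc K) b := by
      rw [hf, add_mul, div_mul_cancel₀ _ hbφ]
    linear_combination algebraMap K[X] (RatFunc K) f.denom * h3
  have h3 : (f.num - f.denom * y).degree < f.denom.degree := by
    have h4 := congrArg degree h1
    rw [degree_mul, degree_mul] at h4
    by_contra hcon
    push Not at hcon
    rw [degree_eq_natDegree f.denom_ne_zero] at hcon h4
    rw [degree_eq_natDegree hb0] at hb h4
    have hr : f.num - f.denom * y ≠ 0 := by
      intro h; rw [h] at hcon; simp at hcon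
    have ha : a ≠ 0 := by
      rintro rfl
      rw [zero_mul] at h1
      exact (mul_ne_zero hr hb0) h1
    rw [degree_eq_natDegree hr] at h4 hcon
    rw [degree_eq_natDegree ha] at h4 hb
    norm_cast at *
    omega
  have h5 := (div_modByMonic_unique y (f.num - f.denom * y) f.monic_denom ⟨by ring, h3⟩).1
  rw [piMinus, h5, hf]
  ring

theorem sISub_eq_map_charmatrix {ι : Type*} [Fintype ι] [DecidableEq ι] (F : Matrix ι ι K) :
    sISub F = (charmatrix F).map (algebraMap K[X] (RatFunc K)) := by
  ext i j
  by_cases h : i = j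
  · subst h
    simp [sISub, charmatrix]
  · simp [sISub, charmatrix, h]

theorem map_algebraMap_eq_map_C {p r : Type*} (M : Matrix p r K) :
    M.map (algebraMap K (RatFunc K)) = (M.map C).map (algebraMap K[X] (RatFunc K)) := by
  ext i j; simp

/-- The entries of `H (sI - F)⁻¹ G` are strictly proper. -/
theorem exists_transfer_apply_eq_div {d q t : ℕ} (F : Matrix (Fin d) (Fin d) K)
    (G : Matrix (Fin d) (Fin t) K)
    (H : Matrix (Fin q) (Fin d) K) (i : Fin q) (j : Fin t) :
    ∃ a : K[X], a.degree < F.charpoly.degree ∧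
      (H.map (algebraMap K (RatFunc K)) * (sISub F)⁻¹ * G.map (algebraMap K (RatFunc K))) i j =
        algebraMap K[X] (RatFunc K) a / algebraMap K[X] (RatFunc K) F.charpoly := by
  refine ⟨(H.map C * (charmatrix F).adjugate * G.map C) i j, ?_, ?_⟩
  · have hb : (⊥ : WithBot ℕ) < F.charpoly.degree :=
      bot_lt_iff_ne_bot.2 (degree_ne_bot.2 F.charpoly_monic.ne_zero)
    simp only [Matrix.mul_apply, Finset.sum_mul, Matrix.map_apply]
    refine (degree_sum_le _ _).trans_lt ((Finset.sup_lt_iff hb).2 fun k _ => ?_)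
    refine (degree_sum_le _ _).trans_lt ((Finset.sup_lt_iff hb).2 fun l _ => ?_)
    rw [mul_assoc, mul_comm _ (C (G k j)), ← smul_eq_C_mul, ← smul_eq_C_mul]
    exact (degree_smul_le _ _).trans_lt
      ((degree_smul_le _ _).trans_lt (degree_adjugate_charmatrix_lt F l k))
  · rw [sISub_eq_map_charmatrix, Matrix.inv_def, map_algebraMap_eq_map_C,
      map_algebraMap_eq_map_C, ← RingHom.mapMatrix_apply,
      ← RingHom.map_det, ← RingHom.map_adjugate, RingHom.mapMatrix_apply, Matrix.mul_smul,
      Matrix.smul_mul, ← Matrix.map_mul, ← Matrix.map_mul, Matrix.smul_apply, Matrix.map_apply,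
      Ring.inverse_eq_inv', smul_eq_mul, inv_mul_eq_div]
    rfl

theorem isUnit_det_sISub {d : ℕ} (F : Matrix (Fin d) (Fin d) K) :
    IsUnit (sISub F).det := by
  rw [sISub_eq_map_charmatrix, ← RingHom.mapMatrix_apply, ← RingHom.map_det, isUnit_iff_ne_zero]
  exact RatFunc.algebraMap_ne_zero F.charpoly_monic.ne_zero

theorem piMinus_transfer {d q t : ℕ} (F : Matrix (Fin d) (Fin d) K) (G : Matrix (Fin d) (Fin t) K)
    (H : Matrix (Fin q) (Fin d) K) (L : Matrix (Fin q) (Fin t) K[X]) :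
    (H.map (algebraMap K (RatFunc K)) * (sISub F)⁻¹ * G.map (algebraMap K (RatFunc K)) +
      L.map (algebraMap K[X] (RatFunc K))).map piMinus =
    H.map (algebraMap K (RatFunc K)) * (sISub F)⁻¹ * G.map (algebraMap K (RatFunc K)) := by
  ext i j
  obtain ⟨a, ha, h⟩ := exists_transfer_apply_eq_div F G H i j
  rw [Matrix.map_apply, Matrix.add_apply, h, Matrix.map_apply, piMinus_div_add _ _ _ ha]

/-- A `K`-basis of the cokernel of `A` yields `F`, the matrix of multiplication by `s`, together
with polynomial matrices relating `A` to `sI - F`, and `S` to a constant matrix modulo `A`. -/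
theorem exists_charmatrix_intertwining {d m t : ℕ} (A : Matrix (Fin m) (Fin m) K[X])
    (S : Matrix (Fin m) (Fin t) K[X])
    (b : Module.Basis (Fin d) K (PolyCokernel A)) :
    ∃ (F : Matrix (Fin d) (Fin d) K) (G : Matrix (Fin d) (Fin t) K)
      (B D : Matrix (Fin m) (Fin d) K[X]) (Q : Matrix (Fin m) (Fin t) K[X]),
      B * charmatrix F = A * D ∧ S = B * G.map C + A * Q := by
  choose c hc using fun i => Submodule.mkQ_surjective (LinearMap.range A.mulVecLin) (b i)
  let B : Matrix (Fin m) (Fin d) K[X] := Matrix.of fun i j => c j i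
  have hB (w : Fin d → K[X]) : (LinearMap.range A.mulVecLin).mkQ (B *ᵥ w) = ∑ i, w i • b i := by
    have : B *ᵥ w = ∑ i, w i • c i := by
      ext1 k
      simp [B, Matrix.mulVec, dotProduct, Finset.sum_apply, mul_comm]
    rw [this, map_sum]
    simp only [map_smul, hc]
  have hmem (v : Fin m → K[X]) (hv : (LinearMap.range A.mulVecLin).mkQ v = 0) :
      ∃ w, A *ᵥ w = v := by
    rw [← LinearMap.mem_ker, Submodule.ker_mkQ] at hv
    exact hv
  have hcol {r : ℕ} (M : Matrix (Fin m) (Fin r) K[X])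
      (hM : ∀ j, (LinearMap.range A.mulVecLin).mkQ (fun i => M i j) = 0) :
      ∃ D : Matrix (Fin m) (Fin r) K[X], M = A * D := by
    choose w hw using fun j => hmem _ (hM j)
    refine ⟨Matrix.of fun i j => w j i, ?_⟩
    ext1 i j
    exact (congrFun (hw j) i).symm
  let F : Matrix (Fin d) (Fin d) K := Matrix.of fun i j => b.repr ((X : K[X]) • b j) i
  let G : Matrix (Fin d) (Fin t) K :=
    Matrix.of fun i j => b.repr ((LinearMap.range A.mulVecLin).mkQ (fun k => S k j)) i
  have hC (k : K) (x : PolyCokernel A) : (C k : K[X]) • x = k • x := by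
    rw [← algebraMap_eq, algebraMap_smul]
  obtain ⟨D, hD⟩ := hcol (B * charmatrix F) (fun j => by
    refine (hB (fun i => charmatrix F i j)).trans ?_
    have : (X : K[X]) • b j = ∑ i, F i j • b i := (b.sum_repr _).symm
    simp only [charmatrix, RingHom.mapMatrix_apply, Matrix.sub_apply, sub_smul,
      Finset.sum_sub_distrib, Matrix.map_apply, hC, ← this]
    simp [Matrix.diagonal_apply, ite_smul])
  obtain ⟨Q, hQ⟩ := hcol (S - B * G.map C) (fun j => by
    have : (LinearMap.range A.mulVecLin).mkQ (fun k => S k j) = ∑ i, G i j • b i :=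
      (b.sum_repr _).symm
    have h2 := hB (fun i => C (G i j))
    simp only [hC, ← this] at h2
    rw [← sub_eq_zero, ← map_sub, ← neg_eq_zero, ← map_neg, neg_sub] at h2
    exact h2)
  exact ⟨F, G, B, D, Q, hD, by rw [← hQ]; abel⟩

/-- Right division of a polynomial matrix by `sI - F`, with constant remainder. -/
theorem exists_eq_map_C_add_mul_charmatrix {q d : ℕ} (F : Matrix (Fin d) (Fin d) K)
    (M : Matrix (Fin q) (Fin d) K[X]) :
    ∃ (H : Matrix (Fin q) (Fin d) K) (L : Matrix (Fin q) (Fin d) K[X]),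
      M = H.map C + L * charmatrix F := by
  choose h l hl using fun i => exists_eq_C_add_vecMul_charmatrix F (M i)
  exact ⟨Matrix.of h, Matrix.of l, by ext1 i j; exact congrFun (hl i) j⟩

theorem isUnit_det_map_algebraMap {m : ℕ} (A : Matrix (Fin m) (Fin m) K[X]) (hA : A.det ≠ 0) :
    IsUnit (A.map (algebraMap K[X] (RatFunc K))).det := by
  rw [← RingHom.mapMatrix_apply, ← RingHom.map_det, isUnit_iff_ne_zero]
  exact RatFunc.algebraMap_ne_zero hA

/-- A realization of `π₋(P A⁻¹ S)` of dimension `deg det A`; coprimeness is not needed. -/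
theorem exists_realization_natDegree_det {q m t : ℕ}
    (P : Matrix (Fin q) (Fin m) (Polynomial K))
    (A : Matrix (Fin m) (Fin m) (Polynomial K))
    (S : Matrix (Fin m) (Fin t) (Polynomial K))
    (hA : A.det ≠ 0) : ∃ (F : Matrix (Fin (A.det.natDegree)) (Fin (A.det.natDegree)) K)
      (G : Matrix (Fin (A.det.natDegree)) (Fin t) K)
      (H : Matrix (Fin q) (Fin (A.det.natDegree)) K),
      H.map (algebraMap K (RatFunc K)) * (sISub F)⁻¹ * G.map (algebraMap K (RatFunc K)) =
        (P.map (algebraMap (Polynomial K) (RatFunc K)) *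
          (A.map (algebraMap (Polynomial K) (RatFunc K)))⁻¹ *
          S.map (algebraMap (Polynomial K) (RatFunc K))).map piMinus := by
  obtain ⟨_, hfr⟩ := finite_and_finrank_polyCokernel A hA
  obtain ⟨F, G, B, D, Q, hD, hS⟩ := exists_charmatrix_intertwining A S
    (Module.finBasisOfFinrankEq K (PolyCokernel A) hfr)
  obtain ⟨H, L, hL⟩ := exists_eq_map_C_add_mul_charmatrix F (P * D)
  refine ⟨F, G, H, ?_⟩
  rw [← piMinus_transfer F G H (L * G.map C + P * Q)]
  congr 1
  let φ := algebraMap K[X] (RatFunc K)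
  have hu := isUnit_det_sISub F
  have hD' := congrArg (fun M => M.map φ) hD
  have hS' := congrArg (fun M => M.map φ) hS
  have hL' := congrArg (fun M => M.map φ) hL
  simp only [Matrix.map_mul, Matrix.map_add _ (map_add φ)] at hD' hS' hL' ⊢
  have hBD : B.map φ = A.map φ * (D.map φ * (sISub F)⁻¹) := by
    rw [← Matrix.mul_assoc, ← hD', ← sISub_eq_map_charmatrix,
      Matrix.mul_nonsing_inv_cancel_right _ _ hu]
  have hH : H.map (algebraMap K (RatFunc K)) * (sISub F)⁻¹ =
      P.map φ * D.map φ * (sISub F)⁻¹ - L.map φ := by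
    rw [hL', ← sISub_eq_map_charmatrix, Matrix.add_mul, Matrix.mul_nonsing_inv_cancel_right _ _ hu,
      map_algebraMap_eq_map_C]
    abel
  have hAS : (A.map φ)⁻¹ * S.map φ = D.map φ * (sISub F)⁻¹ * (G.map C).map φ + Q.map φ := by
    rw [hS', hBD, Matrix.mul_assoc, ← Matrix.mul_add,
      Matrix.nonsing_inv_mul_cancel_left _ _ (isUnit_det_map_algebraMap A hA)]
  rw [hH, Matrix.mul_assoc (P.map _) _ (S.map _), hAS, map_algebraMap_eq_map_C G]
  simp only [Matrix.map_add _ (map_add (algebraMap K[X] (RatFunc K))), Matrix.map_mul,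
    Matrix.mul_add, Matrix.sub_mul, Matrix.mul_assoc, φ]
  abel

/-- A realization of `π₋(P A⁻¹ S)` has dimension at least `deg det A`: the cokernel of `A` is a
quotient of the image of `G` in the cokernel of `sI - F`. -/
theorem natDegree_det_le_of_realization {q m t : ℕ}
    (P : Matrix (Fin q) (Fin m) (Polynomial K))
    (A : Matrix (Fin m) (Fin m) (Polynomial K))
    (S : Matrix (Fin m) (Fin t) (Polynomial K))
    (hA : A.det ≠ 0)
    (hright : ∃ (X : Matrix (Fin m) (Fin m) (Polynomial K))
      (Y : Matrix (Fin m) (Fin q) (Polynomial K)), X * A + Y * P = 1)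
    (hleft : ∃ (X' : Matrix (Fin m) (Fin m) (Polynomial K))
      (Y' : Matrix (Fin t) (Fin m) (Polynomial K)), A * X' + S * Y' = 1)
    (d : ℕ) (F : Matrix (Fin d) (Fin d) K) (G : Matrix (Fin d) (Fin t) K)
    (H : Matrix (Fin q) (Fin d) K)
    (hR : H.map (algebraMap K (RatFunc K)) * (sISub F)⁻¹ * G.map (algebraMap K (RatFunc K)) =
        (P.map (algebraMap (Polynomial K) (RatFunc K)) *
          (A.map (algebraMap (Polynomial K) (RatFunc K)))⁻¹ *
          S.map (algebraMap (Polynomial K) (RatFunc K))).map piMinus) :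
    A.det.natDegree ≤ d := by
  let φ := algebraMap K[X] (RatFunc K)
  obtain ⟨U, Y, hUY⟩ := hright
  obtain ⟨V, W, hVW⟩ := hleft
  obtain ⟨_, hfr⟩ := finite_and_finrank_polyCokernel A hA
  obtain ⟨_, hfr'⟩ := finite_and_finrank_polyCokernel (charmatrix F) F.charpoly_monic.ne_zero
  obtain ⟨L, hL⟩ : ∃ L : Matrix (Fin q) (Fin t) K[X],
      P.map φ * (A.map φ)⁻¹ * S.map φ =
        H.map (algebraMap K (RatFunc K)) * (sISub F)⁻¹ * G.map (algebraMap K (RatFunc K)) +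
        L.map φ := by
    refine ⟨Matrix.of fun i j => ((P.map φ * (A.map φ)⁻¹ * S.map φ) i j).num /ₘ
      ((P.map φ * (A.map φ)⁻¹ * S.map φ) i j).denom, ?_⟩
    rw [hR]
    ext i j
    simp [piMinus, φ]
  have hker (u : Fin t → K[X]) (w : Fin d → K[X]) (huw : charmatrix F *ᵥ w = G.map C *ᵥ u) :
      A *ᵥ (U *ᵥ (S *ᵥ u) + Y *ᵥ (H.map C *ᵥ w + L *ᵥ u)) = S *ᵥ u := by
    have hmv {p r : ℕ} (M : Matrix (Fin p) (Fin r) K[X]) (v : Fin r → K[X]) :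
        φ ∘ (M *ᵥ v) = M.map φ *ᵥ (φ ∘ v) := by
      ext i; exact RingHom.map_mulVec φ M v i
    have hadd {p : ℕ} (v w : Fin p → K[X]) : φ ∘ (v + w) = φ ∘ v + φ ∘ w := by
      ext i; simp
    have hinj : Function.Injective φ := RatFunc.algebraMap_injective K
    have huA := isUnit_det_map_algebraMap A hA
    have huw' := congrArg (fun v => φ ∘ v) huw
    have hUY' := congrArg (fun M => M.map φ) hUY
    have hone : (1 : Matrix (Fin m) (Fin m) K[X]).map φ = 1 := by simp
    simp only [Matrix.map_mul, Matrix.map_add _ (map_add φ), hone] at hUY'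
    apply hinj.comp_left
    simp only [hmv, hadd] at huw' ⊢
    have h1 : (sISub F)⁻¹ *ᵥ ((G.map C).map φ *ᵥ (φ ∘ u)) = φ ∘ w := by
      rw [← huw', ← sISub_eq_map_charmatrix, Matrix.mulVec_mulVec,
        Matrix.nonsing_inv_mul _ (isUnit_det_sISub F),
        Matrix.one_mulVec]
    have h2 : (H.map C).map φ *ᵥ (φ ∘ w) + L.map φ *ᵥ (φ ∘ u) =
        P.map φ *ᵥ ((A.map φ)⁻¹ *ᵥ (S.map φ *ᵥ (φ ∘ u))) := by
      rw [← h1, Matrix.mulVec_mulVec, Matrix.mulVec_mulVec, ← Matrix.add_mulVec,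
        Matrix.mulVec_mulVec, Matrix.mulVec_mulVec, ← map_algebraMap_eq_map_C,
        ← map_algebraMap_eq_map_C, hL]
    set x := (A.map φ)⁻¹ *ᵥ (S.map φ *ᵥ (φ ∘ u)) with hx
    have h3 : A.map φ *ᵥ x = S.map φ *ᵥ (φ ∘ u) := by
      rw [hx, Matrix.mulVec_mulVec, Matrix.mul_nonsing_inv _ huA, Matrix.one_mulVec]
    rw [h2, ← h3, Matrix.mulVec_mulVec x (U.map φ), Matrix.mulVec_mulVec x (Y.map φ),
      ← Matrix.add_mulVec, hUY', Matrix.one_mulVec]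
  let f : (Fin t → K[X]) →ₗ[K[X]] PolyCokernel (charmatrix F) :=
    (LinearMap.range (charmatrix F).mulVecLin).mkQ ∘ₗ (G.map C).mulVecLin
  let g : (Fin t → K[X]) →ₗ[K[X]] PolyCokernel A :=
    (LinearMap.range A.mulVecLin).mkQ ∘ₗ S.mulVecLin
  have hfg : LinearMap.ker f ≤ LinearMap.ker g := by
    intro u hu
    rw [LinearMap.ker_comp, Submodule.ker_mkQ, Submodule.mem_comap] at hu ⊢
    obtain ⟨w, hw⟩ := hu
    exact ⟨_, hker u w hw⟩
  have hg : Function.Surjective g := by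
    intro y
    obtain ⟨v, rfl⟩ := Submodule.mkQ_surjective _ y
    refine ⟨W *ᵥ v, ?_⟩
    change Submodule.Quotient.mk _ = Submodule.Quotient.mk _
    rw [eq_comm, Submodule.Quotient.eq]
    refine ⟨V *ᵥ v, ?_⟩
    simp only [Matrix.mulVecLin_apply, Matrix.mulVec_mulVec]
    rw [eq_sub_iff_add_eq, ← Matrix.add_mulVec, hVW, Matrix.one_mulVec]
  have e1 := (f.quotKerEquivRange).restrictScalars K
  have e2 := (g.quotKerEquivOfSurjective hg).restrictScalars K
  let π := (Submodule.factor hfg).restrictScalars K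
  have hπ : Function.Surjective π := Submodule.factor_surjective hfg
  have hfin : Module.Finite K (LinearMap.range f) :=
    inferInstanceAs (Module.Finite K ((LinearMap.range f).restrictScalars K))
  calc A.det.natDegree = Module.finrank K (PolyCokernel A) := hfr.symm
    _ ≤ Module.finrank K (LinearMap.range f) :=
      LinearMap.finrank_le_finrank_of_surjective
        (f := e2.toLinearMap ∘ₗ π ∘ₗ e1.symm.toLinearMap)
        (e2.surjective.comp (hπ.comp e1.symm.surjective))
    _ ≤ Module.finrank K (PolyCokernel (charmatrix F)) :=
      Submodule.finrank_le ((LinearMap.range f).restrictScalars K)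
    _ = d := by rw [hfr']; exact (F.charpoly_natDegree_eq_dim).trans (Fintype.card_fin d)

/-- Coppel: if `R = P A⁻¹ S` is a coprime factorization, then the
dimension of a minimal realization of `π₋ R` equals `deg det A`: a realization of
dimension `deg det A` exists, and every realization has at least this dimension. -/
theorem minimal_realization_dim_eq_deg_det (q m t : ℕ)
    (P : Matrix (Fin q) (Fin m) (Polynomial K))
    (A : Matrix (Fin m) (Fin m) (Polynomial K))
    (S : Matrix (Fin m) (Fin t) (Polynomial K))
    (hA : A.det ≠ 0)
    (hright : ∃ (X : Matrix (Fin m) (Fin m) (Polynomial K))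
      (Y : Matrix (Fin m) (Fin q) (Polynomial K)), X * A + Y * P = 1)
    (hleft : ∃ (X' : Matrix (Fin m) (Fin m) (Polynomial K))
      (Y' : Matrix (Fin t) (Fin m) (Polynomial K)), A * X' + S * Y' = 1) :
    (∃ (F : Matrix (Fin (A.det.natDegree)) (Fin (A.det.natDegree)) K)
      (G : Matrix (Fin (A.det.natDegree)) (Fin t) K)
      (H : Matrix (Fin q) (Fin (A.det.natDegree)) K),
      H.map (algebraMap K (RatFunc K)) * (sISub F)⁻¹ * G.map (algebraMap K (RatFunc K)) =
        (P.map (algebraMap (Polynomial K) (RatFunc K)) *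
          (A.map (algebraMap (Polynomial K) (RatFunc K)))⁻¹ *
          S.map (algebraMap (Polynomial K) (RatFunc K))).map piMinus) ∧
    ∀ (m' : ℕ) (F' : Matrix (Fin m') (Fin m') K) (G' : Matrix (Fin m') (Fin t) K)
      (H' : Matrix (Fin q) (Fin m') K),
      H'.map (algebraMap K (RatFunc K)) * (sISub F')⁻¹ * G'.map (algebraMap K (RatFunc K)) =
        (P.map (algebraMap (Polynomial K) (RatFunc K)) *
          (A.map (algebraMap (Polynomial K) (RatFunc K)))⁻¹ *
          S.map (algebraMap (Polynomial K) (RatFunc K))).map piMinus →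
      A.det.natDegree ≤ m' :=
  ⟨exists_realization_natDegree_det P A S hA,
    natDegree_det_le_of_realization P A S hA hright hleft⟩

end
end

section
/- Let K be a field, p ∈ K[s] monic irreducible of degree n, and T a strictly proper q×t matrix over K(s) of rank r with Smith–McMillan factorization T = U Σ Vᵀ, where U ∈ K[s]^{q×q} and V ∈ K[s]^{t×t} are unimodular polynomial matrices (determinant a nonzero constant), Σ is the q×t matrix whose only nonzero entries are the diagonal entries a_i / p^{k_i} for i = 1, …, r with a_i ∈ K[s], gcd(p, a_i) = 1, and k_1 ≥ ⋯ ≥ k_r ≥ 0. For each i let ã_i ∈ K[s] be such that π₋( a_i p^{−k_i} ) = ã_i p^{−k_i}, let u_i denote the i-th column of U and v_i the i-th column of V, and set w_i = (u_i · ã_i) · p^{−k_i} · v_iᵀ. Then T = Σ_{i=1}^{r} π₋ w_i. -/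
open Polynomial Matrix Kronecker

set_option synthInstance.maxHeartbeats 1000000
set_option maxHeartbeats 1000000

noncomputable section

variable {K : Type*} [Field K]

theorem isStrictlyProper_div_iff {a b : K[X]} (hb : b ≠ 0) :
    IsStrictlyProper (algebraMap K[X] (RatFunc K) a / algebraMap K[X] (RatFunc K) b) ↔
      a.degree < b.degree := by
  set x := algebraMap K[X] (RatFunc K) a / algebraMap K[X] (RatFunc K) b with hx
  have h : x.num.degree + b.degree = a.degree + x.denom.degree := by
    rw [← degree_mul, ← degree_mul, (RatFunc.num_mul_eq_mul_denom_iff hb).mpr hx]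
  have hd := x.denom_ne_zero
  unfold IsStrictlyProper
  rw [degree_eq_natDegree hb, degree_eq_natDegree hd] at *
  by_cases ha : a = 0
  · have hn : x.num = 0 := by simp [hx, ha]
    simp [hn, ha]
  · have hn : x.num ≠ 0 := by
      intro hn
      have hz : a * x.denom = 0 := by
        rw [← (RatFunc.num_mul_eq_mul_denom_iff hb).mpr hx, hn, zero_mul]
      exact (mul_ne_zero ha hd) hz
    rw [degree_eq_natDegree ha, degree_eq_natDegree hn] at *
    norm_cast at *
    omega

theorem IsStrictlyProper.add {f g : RatFunc K} (hf : IsStrictlyProper f)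
    (hg : IsStrictlyProper g) : IsStrictlyProper (f + g) := by
  have hfd := f.denom_ne_zero
  have hgd := g.denom_ne_zero
  rw [← f.num_div_denom, ← g.num_div_denom,
    div_add_div _ _ (RatFunc.algebraMap_ne_zero hfd) (RatFunc.algebraMap_ne_zero hgd),
    ← map_mul, ← map_mul, ← map_add, ← map_mul,
    isStrictlyProper_div_iff (mul_ne_zero hfd hgd)]
  refine (degree_add_le _ _).trans_lt (max_lt ?_ ?_)
  · rw [degree_mul, degree_mul]
    exact WithBot.add_lt_add_right (degree_ne_bot.mpr hgd) hf
  · rw [degree_mul, degree_mul]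
    exact WithBot.add_lt_add_left (degree_ne_bot.mpr hfd) hg

theorem isStrictlyProper_zero : IsStrictlyProper (0 : RatFunc K) := by
  simp [IsStrictlyProper]

theorem IsStrictlyProper.neg {f : RatFunc K} (hf : IsStrictlyProper f) :
    IsStrictlyProper (-f) := by
  rw [← f.num_div_denom, ← neg_div, ← map_neg, isStrictlyProper_div_iff f.denom_ne_zero,
    degree_neg]
  exact hf

theorem IsStrictlyProper.sum {ι : Type*} (s : Finset ι) (f : ι → RatFunc K)
    (hf : ∀ i ∈ s, IsStrictlyProper (f i)) : IsStrictlyProper (∑ i ∈ s, f i) :=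
  Finset.sum_induction f IsStrictlyProper (fun _ _ => IsStrictlyProper.add)
    isStrictlyProper_zero hf

theorem isStrictlyProper_piMinus (f : RatFunc K) : IsStrictlyProper (piMinus f) := by
  have hd := f.denom_ne_zero
  have h : piMinus f = algebraMap K[X] (RatFunc K) (f.num %ₘ f.denom) /
      algebraMap K[X] (RatFunc K) f.denom := by
    rw [eq_div_iff (RatFunc.algebraMap_ne_zero hd), modByMonic_eq_sub_mul_div,
      map_sub, map_mul, piMinus, sub_mul]
    nth_rw 1 [← f.num_div_denom]
    rw [div_mul_cancel₀ _ (RatFunc.algebraMap_ne_zero hd), mul_comm (algebraMap _ _ f.denom)]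
  rw [h, isStrictlyProper_div_iff hd]
  exact degree_modByMonic_lt _ f.monic_denom

theorem sub_piMinus_mem_range (f : RatFunc K) :
    f - piMinus f ∈ (algebraMap K[X] (RatFunc K)).range :=
  ⟨f.num /ₘ f.denom, by simp [piMinus]⟩

theorem IsStrictlyProper.eq_of_sub_mem_range {f g : RatFunc K} (hf : IsStrictlyProper f)
    (hg : IsStrictlyProper g) (h : f - g ∈ (algebraMap K[X] (RatFunc K)).range) : f = g := by
  obtain ⟨c, hc⟩ := h
  have hfg : IsStrictlyProper (algebraMap K[X] (RatFunc K) c) := by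
    rw [hc, sub_eq_add_neg]
    exact hf.add hg.neg
  have hc0 : c = 0 := by
    by_contra h0
    simp only [IsStrictlyProper, RatFunc.num_algebraMap, RatFunc.denom_algebraMap,
      degree_one, degree_eq_natDegree h0] at hfg
    norm_cast at hfg
  rw [hc0, map_zero] at hc
  exact sub_eq_zero.mp hc.symm

theorem mul_castLE_diagonal_mul_apply {R : Type*} [CommSemiring R] {q t r : ℕ}
    (hrq : r ≤ q) (hrt : r ≤ t) (A : Matrix (Fin q) (Fin q) R) (S : Matrix (Fin q) (Fin t) R)
    (B : Matrix (Fin t) (Fin t) R)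
    (hS : ∀ (i : Fin q) (j : Fin t), ((i : ℕ) ≠ (j : ℕ) ∨ r ≤ (i : ℕ)) → S i j = 0)
    (i : Fin q) (j : Fin t) :
    (A * S * B) i j = ∑ l : Fin r, A i (Fin.castLE hrq l) *
      S (Fin.castLE hrq l) (Fin.castLE hrt l) * B (Fin.castLE hrt l) j := by
  rw [Matrix.mul_apply]
  symm
  refine Finset.sum_of_injOn (Fin.castLE hrt) (Fin.castLE_injective hrt).injOn (by simp) ?_ ?_
  · intro k _ hk
    rw [Matrix.mul_apply, Finset.sum_eq_zero, zero_mul]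
    intro m _
    rw [hS, mul_zero]
    by_contra! hm
    exact hk ⟨⟨m, hm.2⟩, by simp, Fin.ext hm.1⟩
  · intro l _
    rw [Matrix.mul_apply, Finset.sum_eq_single (Fin.castLE hrq l)]
    · intro m _ hm
      rw [hS, mul_zero]
      exact Or.inl fun h => hm (Fin.ext h)
    · simp

/-- via the Smith–McMillan form `T = U Σ Vᵀ`, a strictly proper
matrix `T` of rank `r` decomposes as `T = Σ_{i=1}^r π₋ wᵢ` with
`wᵢ = (uᵢ ãᵢ) p^{-kᵢ} vᵢᵀ`. -/
theorem smith_mcmillan_rank_one_sum (n : ℕ) (hn : 1 ≤ n) (p : Polynomial K)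
    (hp : p.Monic) (hirr : Irreducible p) (hdeg : p.natDegree = n)
    (q t r : ℕ) (hrq : r ≤ q) (hrt : r ≤ t)
    (T : Matrix (Fin q) (Fin t) (RatFunc K))
    (hsp : ∀ a b, IsStrictlyProper (T a b)) (hrank : T.rank = r)
    (U : Matrix (Fin q) (Fin q) (Polynomial K))
    (V : Matrix (Fin t) (Fin t) (Polynomial K))
    (hU : IsUnit U.det) (hV : IsUnit V.det)
    (a : Fin r → Polynomial K) (kk : Fin r → ℕ)
    (hcop : ∀ i, ¬ p ∣ a i)
    (hmono : ∀ i j : Fin r, i ≤ j → kk j ≤ kk i)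
    (Sigma : Matrix (Fin q) (Fin t) (RatFunc K))
    (hSdiag : ∀ l : Fin r, Sigma (Fin.castLE hrq l) (Fin.castLE hrt l) =
      algebraMap (Polynomial K) (RatFunc K) (a l) *
        ((algebraMap (Polynomial K) (RatFunc K) p) ^ (kk l))⁻¹)
    (hSoff : ∀ (i : Fin q) (j : Fin t), ((i : ℕ) ≠ (j : ℕ) ∨ r ≤ (i : ℕ)) →
      Sigma i j = 0)
    (hfact : T = U.map (algebraMap (Polynomial K) (RatFunc K)) * Sigma *
      (Vᵀ).map (algebraMap (Polynomial K) (RatFunc K)))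
    (atil : Fin r → Polynomial K)
    (hatil : ∀ l, piMinus (algebraMap (Polynomial K) (RatFunc K) (a l) *
        ((algebraMap (Polynomial K) (RatFunc K) p) ^ (kk l))⁻¹) =
      algebraMap (Polynomial K) (RatFunc K) (atil l) *
        ((algebraMap (Polynomial K) (RatFunc K) p) ^ (kk l))⁻¹) :
    T = ∑ l : Fin r, Matrix.of fun (i : Fin q) (j : Fin t) =>
      piMinus (algebraMap (Polynomial K) (RatFunc K) (U i (Fin.castLE hrq l) * atil l) *
        ((algebraMap (Polynomial K) (RatFunc K) p) ^ (kk l))⁻¹ *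
        algebraMap (Polynomial K) (RatFunc K) (V j (Fin.castLE hrt l))) := by
  ext i j
  rw [Matrix.sum_apply]
  simp only [Matrix.of_apply]
  refine (hsp i j).eq_of_sub_mem_range
    (IsStrictlyProper.sum _ _ fun l _ => isStrictlyProper_piMinus _) ?_
  rw [hfact, mul_castLE_diagonal_mul_apply hrq hrt _ _ _ hSoff, ← Finset.sum_sub_distrib]
  refine sum_mem fun l _ => ?_
  rw [hSdiag, ← sub_add_sub_cancel]
  refine add_mem ?_ (sub_piMinus_mem_range _)
  have h := sub_piMinus_mem_range (algebraMap (Polynomial K) (RatFunc K) (a l) *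
    ((algebraMap (Polynomial K) (RatFunc K) p) ^ (kk l))⁻¹)
  rw [hatil] at h
  convert mul_mem (mul_mem (RingHom.mem_range_self (algebraMap K[X] (RatFunc K))
    (U i (Fin.castLE hrq l))) h) (RingHom.mem_range_self (algebraMap K[X] (RatFunc K))
    (V j (Fin.castLE hrt l))) using 1
  simp only [Matrix.map_apply, Matrix.transpose_apply, map_mul]
  ring

end
end
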